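/- (Bauer–Fike) Let H ∈ ℂ^{n×n} be diagonalizable as H = Ψ Λ Ψ⁻¹ with Λ diagonal, and let Δ ∈ ℂ^{n×n}. Then for every eigenvalue z of H + Δ there exists an eigenvalue λ of H such that |z − λ| ≤ κ(Ψ) ‖Δ‖₂, where κ(Ψ) = ‖Ψ‖₂‖Ψ⁻¹‖₂. -/

import Mathlib

open Matrix

/-- The spectral (induced 2-) norm of a complex matrix. -/
noncomputable def specNormC {n : ℕ} (M : Matrix (Fin n) (Fin n) ℂ) : ℝ :=
  ‖(Matrix.toEuclideanLin M).toContinuousLinearMap‖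

open scoped Matrix.Norms.L2Operator in
/-- Bauer–Fike for a perturbed diagonal matrix. -/
theorem exists_norm_sub_le_of_diagonal_add_mulVec {ι : Type*} [Fintype ι] [DecidableEq ι]
    (d : ι → ℂ) (E : Matrix ι ι ℂ) (z : ℂ) {w : ι → ℂ} (hw : w ≠ 0)
    (h : (diagonal d + E) *ᵥ w = z • w) : ∃ i, ‖z - d i‖ ≤ ‖E‖ := by
  obtain ⟨j, -⟩ := Function.ne_iff.mp hw
  have : Nonempty ι := ⟨j⟩
  obtain ⟨i, hi⟩ := Finite.exists_min fun i => ‖z - d i‖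
  have hE (k : ι) : (E *ᵥ w) k = (z - d k) * w k := by
    have hk := congrFun h k
    simp only [add_mulVec, Pi.add_apply, mulVec_diagonal, Pi.smul_apply, smul_eq_mul] at hk
    linear_combination hk
  have hlower : ‖z - d i‖ * ‖WithLp.toLp 2 w‖ ≤ ‖WithLp.toLp 2 (E *ᵥ w)‖ := by
    refine le_of_sq_le_sq ?_ (norm_nonneg _)
    rw [mul_pow, EuclideanSpace.norm_sq_eq, EuclideanSpace.norm_sq_eq, Finset.mul_sum]
    refine Finset.sum_le_sum fun k _ => ?_
    simp only [hE, norm_mul, mul_pow]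
    gcongr
    exact hi k
  have hpos : 0 < ‖WithLp.toLp 2 w‖ := by simpa using hw
  exact ⟨i, le_of_mul_le_mul_right (hlower.trans (l2_opNorm_mulVec E (WithLp.toLp 2 w))) hpos⟩

open scoped Matrix.Norms.L2Operator in
theorem specNormC_eq_l2_opNorm {n : ℕ} (M : Matrix (Fin n) (Fin n) ℂ) : specNormC M = ‖M‖ :=
  rfl

/-- (Bauer–Fike) If `H = Ψ Λ Ψ⁻¹` is diagonalizable with `Λ = diagonal d`,
then every eigenvalue `z` of `H + Δ` is within `κ(Ψ)‖Δ‖₂` of some eigenvalue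
`d i` of `H`, where `κ(Ψ) = ‖Ψ‖₂‖Ψ⁻¹‖₂`. -/
theorem bauer_fike {n : ℕ} (H Δ Ψ : Matrix (Fin n) (Fin n) ℂ) (d : Fin n → ℂ)
    (hΨ : IsUnit Ψ.det) (hdiag : H = Ψ * Matrix.diagonal d * Ψ⁻¹)
    (z : ℂ) (v : Fin n → ℂ) (hv : v ≠ 0) (hev : (H + Δ).mulVec v = z • v) :
    ∃ i : Fin n, ‖z - d i‖ ≤ (specNormC Ψ * specNormC Ψ⁻¹) * specNormC Δ := by
  have hΨv : Ψ *ᵥ (Ψ⁻¹ *ᵥ v) = v := by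
    rw [mulVec_mulVec, mul_nonsing_inv _ hΨ, one_mulVec]
  have hw : Ψ⁻¹ *ᵥ v ≠ 0 := fun h0 => hv (by rw [← hΨv, h0, mulVec_zero])
  have hconj : diagonal d + Ψ⁻¹ * Δ * Ψ = Ψ⁻¹ * (H + Δ) * Ψ := by
    rw [hdiag, mul_add, add_mul]
    simp only [mul_assoc, nonsing_inv_mul _ hΨ, mul_one, nonsing_inv_mul_cancel_left _ _ hΨ]
  have hev' : (diagonal d + Ψ⁻¹ * Δ * Ψ) *ᵥ (Ψ⁻¹ *ᵥ v) = z • (Ψ⁻¹ *ᵥ v) := by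
    rw [hconj, ← mulVec_mulVec, hΨv, ← mulVec_mulVec, hev, mulVec_smul]
  obtain ⟨i, hi⟩ := exists_norm_sub_le_of_diagonal_add_mulVec d _ z hw hev'
  refine ⟨i, hi.trans ?_⟩
  simp only [specNormC_eq_l2_opNorm]
  open scoped Matrix.Norms.L2Operator in
  calc ‖Ψ⁻¹ * Δ * Ψ‖ ≤ ‖Ψ⁻¹‖ * ‖Δ‖ * ‖Ψ‖ :=
        (l2_opNorm_mul _ _).trans (by gcongr; exact l2_opNorm_mul _ _)
    _ = ‖Ψ‖ * ‖Ψ⁻¹‖ * ‖Δ‖ := by ring
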